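/- arXiv:2001.07465 — 3 statements merged into one kernel-verified Lean document; each statement's English description precedes it below -/
import Mathlib

section
/- Let n ≥ 2. For all Schwartz functions v ∈ S(ℝⁿ) and all ξ ∈ ℝ^{n−1}, η ∈ ℝ one has F_n^+(−Δv)(ξ,η) = (|ξ|² + η²)(F_n^+ v)(ξ,η) + (2π)^{−1/2}( iη F_{n−1}[v(·,0)](ξ) + F_{n−1}[∂_y v(·,0)](ξ) ), and F_n^−(−Δv)(ξ,η) = (|ξ|² + η²)(F_n^− v)(ξ,η) − (2π)^{−1/2}( iη F_{n−1}[v(·,0)](ξ) + F_{n−1}[∂_y v(·,0)](ξ) ). Moreover, the ranges of F_n^+ and F_n^− (on Schwartz functions) are L²(ℝⁿ)-orthogonal to each other, and F_n = F_n^+ + F_n^−. -/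
open MeasureTheory Complex Filter
open scoped ENNReal InnerProductSpace

noncomputable section

abbrev Rd (d : ℕ) := EuclideanSpace ℝ (Fin d)

/-- The `d`-dimensional Fourier transform with the convention
`F_d g (ξ) = (2π)^{-d/2} ∫ g(x) e^{-i x·ξ} dx`. -/
def FT {d : ℕ} (g : Rd d → ℂ) (ξ : Rd d) : ℂ :=
  (((2 * Real.pi) ^ (-(d : ℝ) / 2) : ℝ) : ℂ) *
    ∫ x : Rd d, Complex.exp (-Complex.I * ((⟪x, ξ⟫_ℝ : ℝ) : ℂ)) * g x

/-- The `n = d+1`-dimensional Fourier transform of a function on ℝⁿ = ℝ^{n-1} × ℝ. -/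
def FTn {d : ℕ} (g : Rd d × ℝ → ℂ) (ξ : Rd d) (η : ℝ) : ℂ :=
  (((2 * Real.pi) ^ (-((d : ℝ) + 1) / 2) : ℝ) : ℂ) *
    ∫ z : Rd d × ℝ, Complex.exp (-Complex.I * (((⟪z.1, ξ⟫_ℝ : ℝ) : ℂ) + z.2 * η)) * g z

/-- The one-sided Fourier transform `F_n^+ g (ξ,η) = F_n (g·1_{y>0}) (ξ,η)`, defined for a
complex frequency η in the last variable. -/
def FTplus {d : ℕ} (g : Rd d × ℝ → ℂ) (ξ : Rd d) (η : ℂ) : ℂ :=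
  (((2 * Real.pi) ^ (-((d : ℝ) + 1) / 2) : ℝ) : ℂ) *
    ∫ z : Rd d × ℝ, (if 0 < z.2 then (1 : ℂ) else 0) *
      Complex.exp (-Complex.I * (((⟪z.1, ξ⟫_ℝ : ℝ) : ℂ) + z.2 * η)) * g z

/-- The one-sided Fourier transform `F_n^- g (ξ,η) = F_n (g·1_{y<0}) (ξ,η)`, defined for a
complex frequency η in the last variable. -/
def FTminus {d : ℕ} (g : Rd d × ℝ → ℂ) (ξ : Rd d) (η : ℂ) : ℂ :=
  (((2 * Real.pi) ^ (-((d : ℝ) + 1) / 2) : ℝ) : ℂ) *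
    ∫ z : Rd d × ℝ, (if z.2 < 0 then (1 : ℂ) else 0) *
      Complex.exp (-Complex.I * (((⟪z.1, ξ⟫_ℝ : ℝ) : ℂ) + z.2 * η)) * g z

/-- The Laplacian of a function on ℝⁿ = ℝ^{n-1} × ℝ. -/
def lapP {d : ℕ} (u : Rd d × ℝ → ℂ) (z : Rd d × ℝ) : ℂ :=
  (∑ i : Fin d,
      fderiv ℝ (fun w => fderiv ℝ u w (EuclideanSpace.single i 1, (0 : ℝ))) z
        (EuclideanSpace.single i 1, (0 : ℝ)))
    + fderiv ℝ (fun w => fderiv ℝ u w ((0 : Rd d), (1 : ℝ))) z ((0 : Rd d), (1 : ℝ))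

section OneSided

open scoped LineDeriv SchwartzMap FourierTransform Convolution

variable {d : ℕ}

/-- The oscillating kernel `e^{-i (x·ξ + y η)}`. -/
def fourierKernel (ξ : Rd d) (η : ℝ) (z : Rd d × ℝ) : ℂ :=
  Complex.exp (-Complex.I * (((⟪z.1, ξ⟫_ℝ : ℝ) : ℂ) + z.2 * η))

lemma continuous_fourierKernel (ξ : Rd d) (η : ℝ) : Continuous (fourierKernel ξ η) := by
  unfold fourierKernel
  fun_prop

lemma norm_fourierKernel (ξ : Rd d) (η : ℝ) (z : Rd d × ℝ) : ‖fourierKernel ξ η z‖ = 1 := by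
  have : fourierKernel ξ η z = Complex.exp ((-(⟪z.1, ξ⟫_ℝ + z.2 * η) : ℝ) * Complex.I) := by
    unfold fourierKernel
    congr 1
    push_cast
    ring
  rw [this, Complex.norm_exp_ofReal_mul_I]

lemma integrable_fourierKernel_mul {ν : Measure (Rd d × ℝ)} {g : Rd d × ℝ → ℂ}
    (hg : Integrable g ν) (ξ : Rd d) (η : ℝ) :
    Integrable (fun z => fourierKernel ξ η z * g z) ν :=
  hg.bdd_mul (continuous_fourierKernel ξ η).aestronglyMeasurable
    (.of_forall fun z => (norm_fourierKernel ξ η z).le)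

lemma SchwartzMap.integrable_prod_restrict (v : 𝓢(Rd d × ℝ, ℂ)) (S : Set ℝ) :
    Integrable (fun z => v z) ((volume : Measure (Rd d)).prod (volume.restrict S)) := by
  have h : Integrable (fun z => v z) ((volume : Measure (Rd d)).prod (volume : Measure ℝ)) :=
    v.integrable
  have := h.restrict (s := Set.univ ×ˢ S)
  rwa [← Measure.prod_restrict, Measure.restrict_univ] at this

lemma SchwartzMap.hasLineDerivAt (v : 𝓢(Rd d × ℝ, ℂ)) (z m : Rd d × ℝ) :
    HasLineDerivAt ℝ v (∂_{m} v z) z m := by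
  rw [SchwartzMap.lineDerivOp_apply_eq_fderiv]
  exact v.differentiableAt.hasFDerivAt.hasLineDerivAt m

lemma hasLineDerivAt_fourierKernel (ξ : Rd d) (η : ℝ) (z m : Rd d × ℝ) :
    HasLineDerivAt ℝ (fourierKernel ξ η)
      (-Complex.I * ((⟪m.1, ξ⟫_ℝ + m.2 * η : ℝ) : ℂ) * fourierKernel ξ η z) z m := by
  have h : HasDerivAt (fun t : ℝ => (((⟪z.1, ξ⟫_ℝ + z.2 * η) +
      t * (⟪m.1, ξ⟫_ℝ + m.2 * η) : ℝ) : ℂ)) ((⟪m.1, ξ⟫_ℝ + m.2 * η : ℝ) : ℂ) 0 := by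
    apply HasDerivAt.ofReal_comp
    simpa using ((hasDerivAt_id (0 : ℝ)).mul_const (⟪m.1, ξ⟫_ℝ + m.2 * η)).const_add
      (⟪z.1, ξ⟫_ℝ + z.2 * η)
  have h2 := (h.const_mul (-Complex.I)).cexp
  unfold HasLineDerivAt fourierKernel
  convert! h2 using 1
  · funext t
    congr 1
    simp [inner_add_left, inner_smul_left]
    ring
  · simp
    ring

/-- The flux whose divergence in direction `m` is `e^{-i (x·ξ + y η)} (∂_m² v + (m·(ξ,η))² v)`. -/
def kernelFlux (v : 𝓢(Rd d × ℝ, ℂ)) (ξ : Rd d) (η : ℝ) (m z : Rd d × ℝ) : ℂ :=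
  fourierKernel ξ η z *
    (∂_{m} v z + Complex.I * ((⟪m.1, ξ⟫_ℝ + m.2 * η : ℝ) : ℂ) * v z)

/-- The derivative of `kernelFlux` in direction `m`. -/
def kernelFluxDeriv (v : 𝓢(Rd d × ℝ, ℂ)) (ξ : Rd d) (η : ℝ) (m z : Rd d × ℝ) : ℂ :=
  fourierKernel ξ η z *
    (∂_{m} (∂_{m} v) z + ((⟪m.1, ξ⟫_ℝ + m.2 * η : ℝ) : ℂ) ^ 2 * v z)

lemma hasLineDerivAt_kernelFlux (v : 𝓢(Rd d × ℝ, ℂ)) (ξ : Rd d) (η : ℝ) (z m : Rd d × ℝ) :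
    HasLineDerivAt ℝ (kernelFlux v ξ η m) (kernelFluxDeriv v ξ η m z) z m := by
  have h1 := hasLineDerivAt_fourierKernel ξ η z m
  have h2 := (∂_{m} v).hasLineDerivAt z m
  have h3 := v.hasLineDerivAt z m
  unfold HasLineDerivAt at *
  have h := h1.mul (h2.add (h3.const_mul (Complex.I * ((⟪m.1, ξ⟫_ℝ + m.2 * η : ℝ) : ℂ))))
  convert! h using 1
  simp only [kernelFluxDeriv, Pi.add_apply, zero_smul, add_zero]
  linear_combination (fourierKernel ξ η z * ((⟪m.1, ξ⟫_ℝ + m.2 * η : ℝ) : ℂ) ^ 2 * v z) *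
    Complex.I_sq

lemma integrable_kernelFlux (v : 𝓢(Rd d × ℝ, ℂ)) (ξ : Rd d) (η : ℝ) (m : Rd d × ℝ) (S : Set ℝ) :
    Integrable (kernelFlux v ξ η m) ((volume : Measure (Rd d)).prod (volume.restrict S)) :=
  integrable_fourierKernel_mul (((∂_{m} v).integrable_prod_restrict S).add
    ((v.integrable_prod_restrict S).const_mul _)) ξ η

lemma integrable_kernelFluxDeriv (v : 𝓢(Rd d × ℝ, ℂ)) (ξ : Rd d) (η : ℝ) (m : Rd d × ℝ)
    (S : Set ℝ) :
    Integrable (kernelFluxDeriv v ξ η m) ((volume : Measure (Rd d)).prod (volume.restrict S)) :=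
  integrable_fourierKernel_mul (((∂_{m} (∂_{m} v)).integrable_prod_restrict S).add
    ((v.integrable_prod_restrict S).const_mul _)) ξ η

lemma integral_kernelFluxDeriv (v : 𝓢(Rd d × ℝ, ℂ)) (ξ : Rd d) (η : ℝ) (m : Rd d × ℝ)
    (S : Set ℝ) :
    ∫ z, kernelFluxDeriv v ξ η m z ∂((volume : Measure (Rd d)).prod (volume.restrict S)) =
      (∫ z, fourierKernel ξ η z * ∂_{m} (∂_{m} v) z
          ∂((volume : Measure (Rd d)).prod (volume.restrict S))) +
        ((⟪m.1, ξ⟫_ℝ + m.2 * η : ℝ) : ℂ) ^ 2 *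
          ∫ z, fourierKernel ξ η z * v z
            ∂((volume : Measure (Rd d)).prod (volume.restrict S)) := by
  rw [← integral_const_mul, ← integral_add]
  · congr 1 with z
    simp only [kernelFluxDeriv]
    ring
  · exact integrable_fourierKernel_mul ((∂_{m} (∂_{m} v)).integrable_prod_restrict S) ξ η
  · exact (integrable_fourierKernel_mul (v.integrable_prod_restrict S) ξ η).const_mul _

lemma integral_eq_zero_of_hasLineDerivAt {E : Type*} [NormedAddCommGroup E] [NormedSpace ℝ E]
    [FiniteDimensional ℝ E] [MeasurableSpace E] [BorelSpace E] {μ : Measure E}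
    [μ.IsAddHaarMeasure] {G G' : E → ℂ} {m : E} (h : ∀ x, HasLineDerivAt ℝ G (G' x) x m)
    (hG : Integrable G μ) (hG' : Integrable G' μ) : ∫ x, G' x ∂μ = 0 := by
  have := integral_bilinear_hasLineDerivAt_right_eq_neg_left_of_integrable (μ := μ) (v := m)
    (f := fun _ => (1 : ℂ)) (f' := fun _ => (0 : ℂ)) (g := G) (g' := G')
    (B := ContinuousLinearMap.mul ℝ ℂ) (by simp) (by simpa using hG') (by simpa using hG)
    (fun x _ => by simpa [HasLineDerivAt] using hasDerivAt_const (0 : ℝ) (1 : ℂ)) (fun x _ => h x)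
  simpa using this

lemma integral_kernelFluxDeriv_horizontal (v : 𝓢(Rd d × ℝ, ℂ)) (ξ : Rd d) (η : ℝ) (m : Rd d)
    (S : Set ℝ) :
    ∫ z, kernelFluxDeriv v ξ η (m, 0) z
      ∂((volume : Measure (Rd d)).prod (volume.restrict S)) = 0 := by
  have h' := integrable_kernelFluxDeriv v ξ η (m, 0) S
  rw [integral_prod_symm _ h']
  apply integral_eq_zero_of_ae
  filter_upwards [h'.prod_left_ae, (integrable_kernelFlux v ξ η (m, 0) S).prod_left_ae]
    with y hy' hy
  refine integral_eq_zero_of_hasLineDerivAt (m := m) (fun x => ?_) hy hy'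
  simpa [HasLineDerivAt] using hasLineDerivAt_kernelFlux v ξ η (x, y) (m, 0)

/-- `S` is a half-line for which the fundamental theorem of calculus has the boundary term
`-σ G(0)`. -/
def HasBoundarySign (S : Set ℝ) (σ : ℂ) : Prop :=
  ∀ G G' : ℝ → ℂ, (∀ y, HasDerivAt G (G' y) y) → IntegrableOn G S → IntegrableOn G' S →
    ∫ y in S, G' y = -(σ * G 0)

lemma hasBoundarySign_Ioi : HasBoundarySign (Set.Ioi 0) 1 := fun G G' h hG hG' => by
  rw [integral_Ioi_of_hasDerivAt_of_tendsto' (fun x _ => h x) hG'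
    (tendsto_zero_of_hasDerivAt_of_integrableOn_Ioi (a := 0) (fun x _ => h x) hG' hG)]
  simp

lemma hasBoundarySign_Iio : HasBoundarySign (Set.Iio 0) (-1) := fun G G' h hG hG' => by
  rw [← integrableOn_Iic_iff_integrableOn_Iio] at hG hG'
  rw [← integral_Iic_eq_integral_Iio,
    integral_Iic_of_hasDerivAt_of_tendsto' (fun x _ => h x) hG'
    (tendsto_zero_of_hasDerivAt_of_integrableOn_Iic (a := 0) (fun x _ => h x) hG' hG)]
  simp

lemma SchwartzMap.integrable_trace (v : 𝓢(Rd d × ℝ, ℂ)) :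
    Integrable (fun x : Rd d => v (x, 0)) := by
  let L : Rd d →ₗᵢ[ℝ] Rd d × ℝ :=
    { toLinearMap := LinearMap.inl ℝ (Rd d) ℝ
      norm_map' := fun x => by simp [Prod.norm_def] }
  exact (SchwartzMap.compCLMOfAntilipschitz ℂ
    (L.toContinuousLinearMap.hasTemperateGrowth) L.antilipschitz v).integrable

lemma integrable_exp_mul {g : Rd d → ℂ} (hg : Integrable g) (ξ : Rd d) :
    Integrable (fun x => Complex.exp (-Complex.I * ((⟪x, ξ⟫_ℝ : ℝ) : ℂ)) * g x) := by
  refine hg.bdd_mul (c := 1) (by fun_prop) (.of_forall fun x => ?_)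
  simpa [fourierKernel] using (norm_fourierKernel ξ 0 (x, 0)).le

lemma integral_kernelFluxDeriv_vertical (v : 𝓢(Rd d × ℝ, ℂ)) (ξ : Rd d) (η : ℝ)
    {S : Set ℝ} {σ : ℂ} (hS : HasBoundarySign S σ) :
    ∫ z, kernelFluxDeriv v ξ η (0, 1) z
      ∂((volume : Measure (Rd d)).prod (volume.restrict S)) =
    -(σ * (Complex.I * η *
        (∫ x : Rd d, Complex.exp (-Complex.I * ((⟪x, ξ⟫_ℝ : ℝ) : ℂ)) * v (x, 0)) +
      ∫ x : Rd d, Complex.exp (-Complex.I * ((⟪x, ξ⟫_ℝ : ℝ) : ℂ)) *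
        ∂_{((0 : Rd d), (1 : ℝ))} v (x, 0))) := by
  have h' := integrable_kernelFluxDeriv v ξ η (0, 1) S
  rw [integral_prod _ h', ← integral_const_mul, ← integral_add, ← integral_const_mul,
    ← integral_neg]
  · apply integral_congr_ae
    filter_upwards [h'.prod_right_ae, (integrable_kernelFlux v ξ η (0, 1) S).prod_right_ae]
      with x hx' hx
    rw [hS (fun y => kernelFlux v ξ η (0, 1) (x, y)) _ (fun y => ?_) hx hx']
    · simp [kernelFlux, fourierKernel]
      left
      ring
    · have h := hasLineDerivAt_kernelFlux v ξ η (x, y) (0, 1)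
      simp only [HasLineDerivAt, Prod.smul_mk, smul_zero, smul_eq_mul, mul_one, Prod.mk_add_mk,
        add_zero] at h
      have := HasDerivAt.comp_sub_const (x := y) (a := y)
        (f := fun t => kernelFlux v ξ η (0, 1) (x, y + t)) (by simpa using h)
      simpa using this
  · exact (integrable_exp_mul v.integrable_trace ξ).const_mul _
  · exact integrable_exp_mul (∂_{((0 : Rd d), (1 : ℝ))} v).integrable_trace ξ

lemma lapP_eq (v : 𝓢(Rd d × ℝ, ℂ)) (z : Rd d × ℝ) :
    lapP (fun w => v w) z =
      (∑ i : Fin d, ∂_{(EuclideanSpace.single i (1 : ℝ), (0 : ℝ))}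
        (∂_{(EuclideanSpace.single i (1 : ℝ), (0 : ℝ))} v) z) +
      ∂_{((0 : Rd d), (1 : ℝ))} (∂_{((0 : Rd d), (1 : ℝ))} v) z := by
  have key : ∀ m : Rd d × ℝ,
      fderiv ℝ (fun w => fderiv ℝ (fun w => v w) w m) z m = ∂_{m} (∂_{m} v) z := fun m => by
    rw [SchwartzMap.lineDerivOp_apply_eq_fderiv]
    rfl
  simp only [lapP, key]

lemma integral_fourierKernel_mul_lapP (v : 𝓢(Rd d × ℝ, ℂ)) (ξ : Rd d) (η : ℝ)
    {S : Set ℝ} {σ : ℂ} (hS : HasBoundarySign S σ) :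
    ∫ z, fourierKernel ξ η z * -(lapP (fun w => v w) z)
      ∂((volume : Measure (Rd d)).prod (volume.restrict S)) =
    ((‖ξ‖ ^ 2 + η ^ 2 : ℝ) : ℂ) * (∫ z, fourierKernel ξ η z * v z
      ∂((volume : Measure (Rd d)).prod (volume.restrict S))) +
    σ * (Complex.I * η *
        (∫ x : Rd d, Complex.exp (-Complex.I * ((⟪x, ξ⟫_ℝ : ℝ) : ℂ)) * v (x, 0)) +
      ∫ x : Rd d, Complex.exp (-Complex.I * ((⟪x, ξ⟫_ℝ : ℝ) : ℂ)) *
        ∂_{((0 : Rd d), (1 : ℝ))} v (x, 0)) := by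
  have hint (m : Rd d × ℝ) := integrable_fourierKernel_mul
    ((∂_{m} (∂_{m} v)).integrable_prod_restrict S) ξ η
  have hv := integral_kernelFluxDeriv_vertical v ξ η hS
  have hh (i : Fin d) :=
    integral_kernelFluxDeriv_horizontal v ξ η (EuclideanSpace.single i (1 : ℝ)) S
  simp only [integral_kernelFluxDeriv, EuclideanSpace.inner_single_left] at hv hh
  simp only [lapP_eq, mul_neg, integral_neg, mul_add, Finset.mul_sum]
  rw [integral_add (integrable_finsetSum _ fun i _ => hint _) (hint _),
    integral_finsetSum _ fun i _ => hint _,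
    Finset.sum_congr rfl fun i _ => eq_neg_of_add_eq_zero_left (hh i), Finset.sum_neg_distrib,
    ← Finset.sum_mul, eq_sub_of_add_eq hv, EuclideanSpace.real_norm_sq_eq]
  simp
  ring

lemma integral_ite_mul {S : Set ℝ} (hS : MeasurableSet S) [DecidablePred (· ∈ S)]
    (F : Rd d × ℝ → ℂ) :
    ∫ z : Rd d × ℝ, (if z.2 ∈ S then (1 : ℂ) else 0) * F z =
      ∫ z, F z ∂((volume : Measure (Rd d)).prod (volume.restrict S)) := by
  have : (volume : Measure (Rd d)).prod (volume.restrict S) =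
      (volume : Measure (Rd d × ℝ)).restrict (Set.univ ×ˢ S) := by
    rw [Measure.volume_eq_prod, ← Measure.prod_restrict, Measure.restrict_univ]
  rw [this, ← integral_indicator (MeasurableSet.univ.prod hS)]
  congr 1 with z
  by_cases h : z.2 ∈ S <;> simp [h, Set.indicator]

lemma FTplus_eq (g : Rd d × ℝ → ℂ) (ξ : Rd d) (η : ℝ) :
    FTplus g ξ η = (((2 * Real.pi) ^ (-((d : ℝ) + 1) / 2) : ℝ) : ℂ) *
      ∫ z, fourierKernel ξ η z * g z
        ∂((volume : Measure (Rd d)).prod (volume.restrict (Set.Ioi 0))) := by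
  rw [FTplus, ← integral_ite_mul measurableSet_Ioi]
  simp only [mul_assoc, Set.mem_Ioi, fourierKernel]

lemma FTminus_eq (g : Rd d × ℝ → ℂ) (ξ : Rd d) (η : ℝ) :
    FTminus g ξ η = (((2 * Real.pi) ^ (-((d : ℝ) + 1) / 2) : ℝ) : ℂ) *
      ∫ z, fourierKernel ξ η z * g z
        ∂((volume : Measure (Rd d)).prod (volume.restrict (Set.Iio 0))) := by
  rw [FTminus, ← integral_ite_mul measurableSet_Iio]
  simp only [mul_assoc, Set.mem_Iio, fourierKernel]

lemma two_pi_rpow_split (d : ℕ) :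
    (((2 * Real.pi) ^ (-((d : ℝ) + 1) / 2) : ℝ) : ℂ) =
      (((2 * Real.pi) ^ (-(1 : ℝ) / 2) : ℝ) : ℂ) *
        (((2 * Real.pi) ^ (-(d : ℝ) / 2) : ℝ) : ℂ) := by
  rw [← Complex.ofReal_mul, ← Real.rpow_add (by positivity)]
  ring_nf

lemma fderiv_eq_lineDerivOp (v : 𝓢(Rd d × ℝ, ℂ)) (z m : Rd d × ℝ) :
    fderiv ℝ (fun w => v w) z m = ∂_{m} v z :=
  (SchwartzMap.lineDerivOp_apply_eq_fderiv m v z).symm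

lemma FTplus_neg_lapP (v : 𝓢(Rd d × ℝ, ℂ)) (ξ : Rd d) (η : ℝ) :
    FTplus (fun z => -(lapP (fun w => v w) z)) ξ (η : ℂ) =
      ((‖ξ‖ ^ 2 + η ^ 2 : ℝ) : ℂ) * FTplus (fun z => v z) ξ (η : ℂ) +
        (((2 * Real.pi) ^ (-(1 : ℝ) / 2) : ℝ) : ℂ) *
          (Complex.I * (η : ℂ) * FT (fun x => v (x, 0)) ξ +
            FT (fun x => fderiv ℝ (fun w => v w) (x, 0) ((0 : Rd d), (1 : ℝ))) ξ) := by
  rw [FTplus_eq, FTplus_eq, integral_fourierKernel_mul_lapP v ξ η hasBoundarySign_Ioi,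
    two_pi_rpow_split]
  simp only [FT, fderiv_eq_lineDerivOp]
  ring

lemma FTminus_neg_lapP (v : 𝓢(Rd d × ℝ, ℂ)) (ξ : Rd d) (η : ℝ) :
    FTminus (fun z => -(lapP (fun w => v w) z)) ξ (η : ℂ) =
      ((‖ξ‖ ^ 2 + η ^ 2 : ℝ) : ℂ) * FTminus (fun z => v z) ξ (η : ℂ) -
        (((2 * Real.pi) ^ (-(1 : ℝ) / 2) : ℝ) : ℂ) *
          (Complex.I * (η : ℂ) * FT (fun x => v (x, 0)) ξ +
            FT (fun x => fderiv ℝ (fun w => v w) (x, 0) ((0 : Rd d), (1 : ℝ))) ξ) := by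
  rw [FTminus_eq, FTminus_eq, integral_fourierKernel_mul_lapP v ξ η hasBoundarySign_Iio,
    two_pi_rpow_split]
  simp only [FT, fderiv_eq_lineDerivOp]
  ring

lemma FTn_eq_add (f : 𝓢(Rd d × ℝ, ℂ)) (ξ : Rd d) (η : ℝ) :
    FTn (fun z => f z) ξ η =
      FTplus (fun z => f z) ξ (η : ℂ) + FTminus (fun z => f z) ξ (η : ℂ) := by
  have h (S : Set ℝ) := integrable_fourierKernel_mul (f.integrable_prod_restrict S) ξ η
  have hsplit : (volume : Measure ℝ) =
      volume.restrict (Set.Ioi 0) + volume.restrict (Set.Iio 0) := by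
    rw [restrict_Iio_eq_restrict_Iic, add_comm, ← Set.compl_Iic,
      Measure.restrict_add_restrict_compl measurableSet_Iic]
  have hprod : (volume : Measure (Rd d × ℝ)) =
      (volume : Measure (Rd d)).prod (volume.restrict (Set.Ioi 0)) +
        (volume : Measure (Rd d)).prod (volume.restrict (Set.Iio 0)) := by
    rw [← Measure.prod_add, ← hsplit, Measure.volume_eq_prod]
  rw [FTplus_eq, FTminus_eq, ← mul_add, ← integral_add_measure (h _) (h _), ← hprod]
  rfl

/-- The Fourier transforms of two integrable functions supported in the positive half-line have
vanishing bilinear pairing. -/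
lemma integral_fourier_mul_fourier_eq_zero {p r : ℝ → ℂ} (hp : Integrable p) (hr : Integrable r)
    (hp0 : ∀ y ≤ 0, p y = 0) (hr0 : ∀ y ≤ 0, r y = 0) : ∫ t, 𝓕 p t * 𝓕 r t = 0 := by
  by_cases hint : Integrable (fun t => 𝓕 p t * 𝓕 r t)
  swap
  · exact integral_undef hint
  set k : ℝ → ℂ := p ⋆[ContinuousLinearMap.mul ℂ ℂ] r with hk
  have hkint : Integrable k := hp.integrable_convolution _ hr
  have hFk : 𝓕 k = fun t => 𝓕 p t * 𝓕 r t :=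
    funext fun t => Real.fourier_mul_convolution_eq hp hr t
  rw [← hFk] at hint ⊢
  have hk0 : ∀ y < 0, k y = 0 := fun y hy => by
    rw [hk, convolution_def]
    refine integral_eq_zero_of_ae (.of_forall fun t => ?_)
    rcases le_total t 0 with ht | ht
    · simp [hp0 t ht]
    · simp [hr0 (y - t) (by linarith)]
  have hinv : ∀ y < 0, 𝓕⁻ (𝓕 k) y = 0 := fun y hy => by
    have hev : k =ᶠ[nhds y] fun _ => 0 := by
      filter_upwards [Iio_mem_nhds hy] with t ht using hk0 t ht
    rw [hkint.fourierInv_fourier_eq hint (continuousAt_const.congr hev.symm), hk0 y hy]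
  have hcont : Continuous (𝓕⁻ (𝓕 k)) := by
    have : 𝓕⁻ (𝓕 k) = fun y => 𝓕 (𝓕 k) (-y) := funext fun y => Real.fourierInv_eq_fourier_neg _ _
    rw [this]
    exact (VectorFourier.fourierIntegral_continuous Real.continuous_fourierChar
      (by fun_prop) hint).comp continuous_neg
  have hzero : 𝓕⁻ (𝓕 k) 0 = 0 := by
    have h1 : Tendsto (𝓕⁻ (𝓕 k)) (nhdsWithin 0 (Set.Iio 0)) (nhds (𝓕⁻ (𝓕 k) 0)) :=
      hcont.continuousAt.mono_left nhdsWithin_le_nhds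
    refine tendsto_nhds_unique h1 (tendsto_const_nhds.congr' ?_)
    filter_upwards [self_mem_nhdsWithin] with y hy using (hinv y hy).symm
  simpa [Real.fourierInv_eq] using hzero

/-- The partial Fourier transform in the first variable, cut off to `S` in the last one. -/
def partialFT (S : Set ℝ) (g : Rd d × ℝ → ℂ) (ξ : Rd d) : ℝ → ℂ :=
  S.indicator fun y => ∫ x : Rd d, fourierKernel ξ 0 (x, y) * g (x, y)

lemma integrable_partialFT {S : Set ℝ} (hS : MeasurableSet S) (f : 𝓢(Rd d × ℝ, ℂ)) (ξ : Rd d) :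
    Integrable (partialFT S (fun z => f z) ξ) := by
  rw [partialFT, integrable_indicator_iff hS]
  exact (integrable_fourierKernel_mul (f.integrable_prod_restrict S) ξ 0).integral_prod_right

lemma integral_fourierKernel_mul_eq_fourier {S : Set ℝ} (hS : MeasurableSet S)
    (f : 𝓢(Rd d × ℝ, ℂ)) (ξ : Rd d) (η : ℝ) :
    ∫ z, fourierKernel ξ η z * f z ∂((volume : Measure (Rd d)).prod (volume.restrict S)) =
      𝓕 (partialFT S (fun z => f z) ξ) (η / (2 * Real.pi)) := by
  rw [integral_prod_symm _ (integrable_fourierKernel_mul (f.integrable_prod_restrict S) ξ η),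
    Real.fourier_real_eq_integral_exp_smul, ← integral_indicator hS]
  congr 1 with y
  by_cases hy : y ∈ S
  · rw [partialFT, Set.indicator_of_mem hy, Set.indicator_of_mem hy, smul_eq_mul,
      ← integral_const_mul]
    congr 1 with x
    rw [← mul_assoc]
    congr 1
    rw [fourierKernel, fourierKernel, ← Complex.exp_add]
    congr 1
    push_cast
    field_simp
    ring
  · simp [partialFT, hy]

lemma conj_fourier (q : ℝ → ℂ) (t : ℝ) :
    starRingEnd ℂ (𝓕 q t) = 𝓕 (fun y => starRingEnd ℂ (q (-y))) t := by
  rw [Real.fourier_real_eq_integral_exp_smul, Real.fourier_real_eq_integral_exp_smul,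
    ← integral_conj, ← integral_neg_eq_self]
  congr 1 with y
  simp [← Complex.exp_conj, Complex.conj_ofNat]

lemma integral_FTplus_mul_conj_FTminus (f g : 𝓢(Rd d × ℝ, ℂ)) :
    ∫ w : Rd d × ℝ,
      FTplus (fun z => f z) w.1 (w.2 : ℂ) *
        (starRingEnd ℂ) (FTminus (fun z => g z) w.1 (w.2 : ℂ)) = 0 := by
  by_cases hint : Integrable (fun w : Rd d × ℝ => FTplus (fun z => f z) w.1 (w.2 : ℂ) *
        (starRingEnd ℂ) (FTminus (fun z => g z) w.1 (w.2 : ℂ)))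
  swap
  · exact integral_undef hint
  rw [Measure.volume_eq_prod] at hint ⊢
  rw [integral_prod _ hint]
  refine integral_eq_zero_of_ae (.of_forall fun ξ => ?_)
  simp only [FTplus_eq, FTminus_eq, integral_fourierKernel_mul_eq_fourier measurableSet_Ioi,
    integral_fourierKernel_mul_eq_fourier measurableSet_Iio, map_mul, Complex.conj_ofReal,
    conj_fourier, mul_mul_mul_comm, integral_const_mul]
  have hq := integrable_partialFT (measurableSet_Iio (a := 0)) g ξ
  have key := integral_fourier_mul_fourier_eq_zero (integrable_partialFT (measurableSet_Ioi (a := 0)) f ξ)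
    (r := fun y => starRingEnd ℂ (partialFT (Set.Iio 0) (fun z => g z) ξ (-y)))
    ((LinearIsometryEquiv.integrable_comp_iff Complex.conjLIE).2 hq.comp_neg)
    (fun y hy => Set.indicator_of_notMem (by simpa using hy) _)
    (fun y hy => by
      rw [partialFT, Set.indicator_of_notMem (by simpa using hy), map_zero])
  rw [Measure.integral_comp_div (fun t => 𝓕 (partialFT (Set.Ioi 0) (fun z => f z) ξ) t *
    𝓕 (fun y => starRingEnd ℂ (partialFT (Set.Iio 0) (fun z => g z) ξ (-y))) t), key]
  simp

end OneSided

/-- **Proposition (one-sided Fourier transforms).** For every Schwartz function v on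
ℝⁿ = ℝ^{n-1} × ℝ (n = d+1 ≥ 2) and all ξ ∈ ℝ^{n-1}, η ∈ ℝ:
`F_n^±(-Δv)(ξ,η) = (|ξ|²+η²) F_n^± v(ξ,η) ± (2π)^{-1/2}(iη F_{n-1}[v(·,0)](ξ) + F_{n-1}[∂_y v(·,0)](ξ))`;
moreover the ranges of F_n^+ and F_n^- are L²-orthogonal and `F_n = F_n^+ + F_n^-`. -/
theorem stmt_8 (n d : ℕ) (hn : 2 ≤ n) (hnd : n = d + 1) :
    (∀ v : SchwartzMap (Rd d × ℝ) ℂ, ∀ ξ : Rd d, ∀ η : ℝ,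
      FTplus (fun z => -(lapP (fun w => v w) z)) ξ (η : ℂ) =
        ((‖ξ‖ ^ 2 + η ^ 2 : ℝ) : ℂ) * FTplus (fun z => v z) ξ (η : ℂ) +
          (((2 * Real.pi) ^ (-(1 : ℝ) / 2) : ℝ) : ℂ) *
            (Complex.I * (η : ℂ) * FT (fun x => v (x, 0)) ξ +
              FT (fun x => fderiv ℝ (fun w => v w) (x, 0) ((0 : Rd d), (1 : ℝ))) ξ)) ∧
    (∀ v : SchwartzMap (Rd d × ℝ) ℂ, ∀ ξ : Rd d, ∀ η : ℝ,
      FTminus (fun z => -(lapP (fun w => v w) z)) ξ (η : ℂ) =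
        ((‖ξ‖ ^ 2 + η ^ 2 : ℝ) : ℂ) * FTminus (fun z => v z) ξ (η : ℂ) -
          (((2 * Real.pi) ^ (-(1 : ℝ) / 2) : ℝ) : ℂ) *
            (Complex.I * (η : ℂ) * FT (fun x => v (x, 0)) ξ +
              FT (fun x => fderiv ℝ (fun w => v w) (x, 0) ((0 : Rd d), (1 : ℝ))) ξ)) ∧
    -- the ranges of F_n^+ and F_n^- are orthogonal in L²(ℝⁿ)
    (∀ f g : SchwartzMap (Rd d × ℝ) ℂ,
      ∫ w : Rd d × ℝ,
        FTplus (fun z => f z) w.1 (w.2 : ℂ) *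
          (starRingEnd ℂ) (FTminus (fun z => g z) w.1 (w.2 : ℂ)) = 0) ∧
    -- F_n = F_n^+ + F_n^-
    (∀ f : SchwartzMap (Rd d × ℝ) ℂ, ∀ ξ : Rd d, ∀ η : ℝ,
      FTn (fun z => f z) ξ η =
        FTplus (fun z => f z) ξ (η : ℂ) + FTminus (fun z => f z) ξ (η : ℂ)) := by
  exact ⟨FTplus_neg_lapP, FTminus_neg_lapP, integral_FTplus_mul_conj_FTminus, FTn_eq_add⟩
end
end

section
/- Let δ ∈ (0,1) and a ∈ C¹([0,1]). Then there is a constant C depending only on δ such that for all c > 0, | ∫₀¹ e^{icρ} a(ρ) ρ^{−δ} dρ | ≤ C (1+c)^{δ−1} ( |a(0)| + ‖a'‖_∞ ). -/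
open MeasureTheory Complex Filter
open scoped ENNReal

noncomputable section

/-- The primitive of `ρ ↦ exp (I c ρ)` vanishing at `0` is `O((1 + c)⁻¹)` on `[0, 1]`. -/
theorem norm_exp_sub_one_div_le {c ρ : ℝ} (hc : 0 < c) (hρ : ρ ∈ Set.Icc (0 : ℝ) 1) :
    ‖(exp (I * c * ρ) - 1) / (I * c)‖ ≤ 3 * (1 + c)⁻¹ := by
  have hrw : I * (c : ℂ) * ρ = I * ((c * ρ : ℝ) : ℂ) := by push_cast; ring
  rw [hrw, norm_div, norm_mul, norm_I, one_mul, norm_real, Real.norm_of_nonneg hc.le,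
    div_le_iff₀ hc, mul_assoc, ← div_eq_inv_mul, mul_div_assoc', le_div_iff₀ (by positivity)]
  have h₁ : ‖exp (I * ((c * ρ : ℝ) : ℂ)) - 1‖ ≤ c := by
    refine Real.norm_exp_I_mul_ofReal_sub_one_le.trans ?_
    rw [Real.norm_of_nonneg (mul_nonneg hc.le hρ.1)]
    exact mul_le_of_le_one_right hc.le hρ.2
  have h₂ : ‖exp (I * ((c * ρ : ℝ) : ℂ)) - 1‖ ≤ 2 := by
    refine (norm_sub_le _ _).trans ?_
    rw [norm_exp_I_mul_ofReal, norm_one]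
    norm_num
  nlinarith

theorem hasDerivAt_exp_sub_one_div {c : ℝ} (hc : c ≠ 0) (ρ : ℝ) :
    HasDerivAt (fun ρ : ℝ => (exp (I * c * ρ) - 1) / (I * c)) (exp (I * c * ρ)) ρ := by
  have hIc : I * (c : ℂ) ≠ 0 := mul_ne_zero I_ne_zero (ofReal_ne_zero.2 hc)
  have h := (((hasDerivAt_id (ρ : ℂ)).const_mul (I * c)).cexp.comp_ofReal.sub_const 1).div_const
    (I * c)
  refine h.congr_deriv ?_
  simp [hIc]

/-- The integral of a function dominated by `B ρ ^ (-δ)` near the origin. -/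
theorem norm_integral_zero_le_of_norm_le_rpow {f : ℝ → ℂ} {δ B ε : ℝ} (hδ : δ < 1) (hε : 0 ≤ ε)
    (hf : ∀ ρ ∈ Set.Ioc 0 ε, ‖f ρ‖ ≤ B * ρ ^ (-δ)) :
    ‖∫ ρ in (0 : ℝ)..ε, f ρ‖ ≤ B * (ε ^ (1 - δ) / (1 - δ)) := by
  have hδ' : -1 < -δ := by linarith
  refine (intervalIntegral.norm_integral_le_of_norm_le hε (ae_of_all _ hf)
    ((intervalIntegral.intervalIntegrable_rpow' hδ').const_mul B)).trans_eq ?_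
  rw [intervalIntegral.integral_const_mul, integral_rpow (Or.inl hδ'), neg_add_eq_sub,
    Real.zero_rpow (by linarith), sub_zero]

/-- Integration by parts away from the singularity, against a bounded primitive `v`. -/
theorem norm_integral_mul_rpow_le {a a' v v' : ℝ → ℂ} {δ B K ε : ℝ} (hδ : 0 < δ)
    (hε : 0 < ε) (hε₁ : ε ≤ 1) (hB : 0 ≤ B) (hK : 0 ≤ K)
    (ha : ∀ ρ ∈ Set.Icc ε 1, HasDerivWithinAt a (a' ρ) (Set.Icc ε 1) ρ)
    (ha' : ContinuousOn a' (Set.Icc ε 1))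
    (haB : ∀ ρ ∈ Set.Icc ε 1, ‖a ρ‖ ≤ B) (ha'B : ∀ ρ ∈ Set.Icc ε 1, ‖a' ρ‖ ≤ B)
    (hv : ∀ ρ, HasDerivAt v (v' ρ) ρ) (hv' : Continuous v')
    (hvK : ∀ ρ ∈ Set.Icc ε 1, ‖v ρ‖ ≤ K) :
    ‖∫ ρ in ε..1, a ρ * ((ρ ^ (-δ) : ℝ) : ℂ) * v' ρ‖ ≤
      B * K * ((2 + (1 + δ) / δ) * ε ^ (-δ)) := by
  have hpos : ∀ ρ ∈ Set.Icc ε 1, 0 < ρ := fun ρ hρ => hε.trans_le hρ.1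
  have hsub : Set.uIcc ε 1 = Set.Icc ε 1 := Set.uIcc_of_le hε₁
  have h0 : (0 : ℝ) ∉ Set.uIcc ε 1 := fun h => (hpos 0 (hsub ▸ h)).false
  have hrpow : ∀ r : ℝ, ContinuousOn (fun ρ : ℝ => ((ρ ^ r : ℝ) : ℂ)) (Set.Icc ε 1) := fun r =>
    continuous_ofReal.comp_continuousOn
      (continuousOn_id.rpow_const fun ρ hρ => Or.inl (hpos ρ hρ).ne')
  have hac : ContinuousOn a (Set.Icc ε 1) := fun ρ hρ => (ha ρ hρ).continuousWithinAt
  let u' : ℝ → ℂ := fun ρ =>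
    a' ρ * ((ρ ^ (-δ) : ℝ) : ℂ) + a ρ * ((-δ * ρ ^ (-δ - 1) : ℝ) : ℂ)
  have hu : ∀ ρ ∈ Set.Icc ε 1,
      HasDerivWithinAt (fun ρ => a ρ * ((ρ ^ (-δ) : ℝ) : ℂ)) (u' ρ) (Set.Icc ε 1) ρ :=
    fun ρ hρ => (ha ρ hρ).mul
      (Real.hasDerivAt_rpow_const (Or.inl (hpos ρ hρ).ne')).ofReal_comp.hasDerivWithinAt
  have hu'c : ContinuousOn u' (Set.Icc ε 1) := by
    refine (ha'.mul (hrpow _)).add (hac.mul ?_)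
    simp only [ofReal_mul]
    exact continuousOn_const.mul (hrpow (-δ - 1))
  have hu'B : ∀ ρ ∈ Set.Icc ε 1, ‖u' ρ‖ ≤ B * (1 + δ) * ρ ^ (-δ - 1) := by
    intro ρ hρ
    have hρ₀ := hpos ρ hρ
    have hmono : ρ ^ (-δ) ≤ ρ ^ (-δ - 1) :=
      Real.rpow_le_rpow_of_exponent_ge hρ₀ hρ.2 (by linarith)
    calc ‖u' ρ‖ ≤ ‖a' ρ‖ * ρ ^ (-δ) + ‖a ρ‖ * (δ * ρ ^ (-δ - 1)) := by
          refine (norm_add_le _ _).trans_eq ?_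
          rw [norm_mul, norm_mul, norm_real, norm_real, norm_mul, norm_neg,
            Real.norm_of_nonneg hδ.le, Real.norm_of_nonneg (by positivity),
            Real.norm_of_nonneg (by positivity)]
      _ ≤ B * ρ ^ (-δ - 1) + B * (δ * ρ ^ (-δ - 1)) := by
          gcongr
          exacts [ha'B ρ hρ, haB ρ hρ]
      _ = B * (1 + δ) * ρ ^ (-δ - 1) := by ring
  have hbdry : ∀ ρ ∈ Set.Icc ε 1, ‖a ρ * ((ρ ^ (-δ) : ℝ) : ℂ) * v ρ‖ ≤ B * K * ε ^ (-δ) := by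
    intro ρ hρ
    have hmono : ρ ^ (-δ) ≤ ε ^ (-δ) := Real.rpow_le_rpow_of_nonpos hε hρ.1 (by linarith)
    have hρ₀ := hpos ρ hρ
    rw [norm_mul, norm_mul, norm_real, Real.norm_of_nonneg (by positivity), mul_right_comm B K]
    gcongr
    exacts [haB ρ hρ, hvK ρ hρ]
  have hderiv : ‖∫ ρ in ε..1, u' ρ * v ρ‖ ≤ B * K * ((1 + δ) / δ * ε ^ (-δ)) := by
    refine (intervalIntegral.norm_integral_le_of_norm_le
      (g := fun ρ => B * K * (1 + δ) * ρ ^ (-δ - 1)) hε₁ (ae_of_all _ fun ρ hρ => ?_)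
      ((intervalIntegral.intervalIntegrable_rpow (Or.inr h0)).const_mul _)).trans ?_
    · have hρ' := Set.Ioc_subset_Icc_self hρ
      have hρ₀ := hpos ρ hρ'
      calc ‖u' ρ * v ρ‖ ≤ B * (1 + δ) * ρ ^ (-δ - 1) * K := by
            rw [norm_mul]
            gcongr
            exacts [hu'B ρ hρ', hvK ρ hρ']
        _ = B * K * (1 + δ) * ρ ^ (-δ - 1) := by ring
    · rw [intervalIntegral.integral_const_mul, integral_rpow (Or.inr ⟨by linarith, h0⟩),
        sub_add_cancel, Real.one_rpow, mul_assoc]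
      refine mul_le_mul_of_nonneg_left ?_ (by positivity)
      rw [div_neg, ← neg_div, neg_sub, mul_div_assoc', div_mul_eq_mul_div]
      gcongr
      linarith
  rw [intervalIntegral.integral_mul_deriv_eq_deriv_mul_of_hasDerivWithinAt
    (u' := u') (v := v) (by rwa [hsub]) (fun ρ _ => (hv ρ).hasDerivWithinAt)
    (by rw [← hsub] at hu'c; exact hu'c.intervalIntegrable) (hv'.intervalIntegrable _ _)]
  calc _ ≤ B * K * ε ^ (-δ) + B * K * ε ^ (-δ) + B * K * ((1 + δ) / δ * ε ^ (-δ)) :=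
        (norm_sub_le _ _).trans <| add_le_add ((norm_sub_le _ _).trans <|
          add_le_add (hbdry 1 ⟨hε₁, le_rfl⟩) (hbdry ε ⟨le_rfl, hε₁⟩)) hderiv
    _ = _ := by ring

/-- The real supremum over a nonempty compact set, written as a double `⨆`, bounds the norm. -/
theorem ContinuousOn.norm_le_biSup {f : ℝ → ℂ} {s : Set ℝ} (hs : IsCompact s)
    (hf : ContinuousOn f s) {x : ℝ} (hx : x ∈ s) : ‖f x‖ ≤ ⨆ y ∈ s, ‖f y‖ := by
  obtain ⟨M, hM⟩ := hs.exists_bound_of_continuousOn hf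
  refine le_ciSup₂ (f := fun y (_ : y ∈ s) => ‖f y‖) ⟨M, ?_⟩ x hx
  rintro _ ⟨_, ⟨y, rfl⟩, hy, rfl⟩
  exact hM y hy

/-- **Proposition (singular oscillatory integral, upper bound).** Let δ ∈ (0,1) and
a ∈ C¹([0,1]) (given with its derivative a' on [0,1]). There is C = C(δ) > 0 such that
for all c > 0: |∫₀¹ e^{icρ} a(ρ) ρ^{−δ} dρ| ≤ C (1+c)^{δ−1} (|a(0)| + ‖a'‖_∞). -/
theorem stmt_10 (δ : ℝ) (hδ : δ ∈ Set.Ioo (0 : ℝ) 1) :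
    ∃ C : ℝ, 0 < C ∧ ∀ a a' : ℝ → ℂ,
      (∀ ρ ∈ Set.Icc (0 : ℝ) 1, HasDerivWithinAt a (a' ρ) (Set.Icc (0 : ℝ) 1) ρ) →
      ContinuousOn a' (Set.Icc (0 : ℝ) 1) →
      ∀ c : ℝ, 0 < c →
        ‖∫ ρ in (0 : ℝ)..1, Complex.exp (Complex.I * c * ρ) * a ρ * ((ρ ^ (-δ) : ℝ) : ℂ)‖ ≤
          C * (1 + c) ^ (δ - 1) * (‖a 0‖ + ⨆ ρ ∈ Set.Icc (0 : ℝ) 1, ‖a' ρ‖) := by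
  obtain ⟨hδ₀, hδ₁⟩ := hδ
  have h1δ : 0 < 1 - δ := by linarith
  refine ⟨1 / (1 - δ) + 3 * (2 + (1 + δ) / δ), by positivity, fun a a' ha ha' c hc => ?_⟩
  set M := ⨆ ρ ∈ Set.Icc (0 : ℝ) 1, ‖a' ρ‖
  have hM : ∀ ρ ∈ Set.Icc (0 : ℝ) 1, ‖a' ρ‖ ≤ M := fun ρ hρ => ha'.norm_le_biSup isCompact_Icc hρ
  have hM₀ : 0 ≤ M := (norm_nonneg _).trans (hM 0 (by simp))
  set B := ‖a 0‖ + M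
  have hB : 0 ≤ B := by positivity
  have haB : ∀ ρ ∈ Set.Icc (0 : ℝ) 1, ‖a ρ‖ ≤ B := by
    intro ρ hρ
    have h := norm_image_sub_le_of_norm_deriv_le_segment' ha
      (fun x hx => hM x (Set.Ico_subset_Icc_self hx)) ρ hρ
    have h' : ‖a ρ‖ ≤ ‖a 0‖ + ‖a ρ - a 0‖ := norm_le_norm_add_norm_sub' _ _
    nlinarith [hρ.2]
  have hac : ContinuousOn a (Set.Icc 0 1) := fun ρ hρ => (ha ρ hρ).continuousWithinAt
  have hexp : Continuous fun ρ : ℝ => exp (I * c * ρ) := by fun_prop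
  set ε := (1 + c)⁻¹
  have hε : 0 < ε := by positivity
  have hε₁ : ε ≤ 1 := inv_le_one_of_one_le₀ (by linarith)
  have hsub : Set.Icc ε 1 ⊆ Set.Icc 0 1 := Set.Icc_subset_Icc_left hε.le
  have hpow : (1 + c) ^ (δ - 1) = ε ^ (1 - δ) := by
    rw [Real.inv_rpow (by positivity), ← Real.rpow_neg (by positivity), neg_sub]
  have hεpow : ε * ε ^ (-δ) = ε ^ (1 - δ) := by
    rw [sub_eq_add_neg, Real.rpow_add hε, Real.rpow_one]
  have hInt : IntervalIntegrable
      (fun ρ : ℝ => exp (I * c * ρ) * a ρ * ((ρ ^ (-δ) : ℝ) : ℂ)) volume 0 1 := by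
    have hr : IntervalIntegrable (fun ρ : ℝ => ((ρ ^ (-δ) : ℝ) : ℂ)) volume 0 1 := by
      have h := intervalIntegral.intervalIntegrable_rpow' (a := 0) (b := 1)
        (by linarith : -1 < -δ)
      exact ⟨h.1.ofReal, h.2.ofReal⟩
    refine hr.continuousOn_mul ?_
    rw [Set.uIcc_of_le zero_le_one]
    exact hexp.continuousOn.mul hac
  have hmem : ε ∈ Set.uIcc (0 : ℝ) 1 := by
    rw [Set.uIcc_of_le zero_le_one]
    exact ⟨hε.le, hε₁⟩
  rw [← intervalIntegral.integral_add_adjacent_intervals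
    (hInt.mono_set (Set.uIcc_subset_uIcc_left hmem))
    (hInt.mono_set (Set.uIcc_subset_uIcc_right hmem)), hpow]
  have hnear : ‖∫ ρ in (0 : ℝ)..ε, exp (I * c * ρ) * a ρ * ((ρ ^ (-δ) : ℝ) : ℂ)‖ ≤
      B * (ε ^ (1 - δ) / (1 - δ)) := by
    refine norm_integral_zero_le_of_norm_le_rpow hδ₁ hε.le fun ρ hρ => ?_
    have hρ₀ := hρ.1
    have hone : ‖exp (I * c * ρ)‖ = 1 := by
      rw [mul_assoc, ← ofReal_mul, norm_exp_I_mul_ofReal]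
    rw [norm_mul, norm_mul, norm_real, Real.norm_of_nonneg (by positivity), hone, one_mul]
    gcongr
    exact haB ρ ⟨hρ₀.le, hρ.2.trans hε₁⟩
  have hfar : ‖∫ ρ in ε..1, exp (I * c * ρ) * a ρ * ((ρ ^ (-δ) : ℝ) : ℂ)‖ ≤
      B * (3 * ε) * ((2 + (1 + δ) / δ) * ε ^ (-δ)) := by
    have h := norm_integral_mul_rpow_le hδ₀ hε hε₁ hB (by positivity : 0 ≤ 3 * ε)
      (fun ρ hρ => (ha ρ (hsub hρ)).mono hsub) (ha'.mono hsub) (fun ρ hρ => haB ρ (hsub hρ))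
      (fun ρ hρ => hM ρ (hsub hρ) |>.trans (le_add_of_nonneg_left (norm_nonneg _)))
      (hasDerivAt_exp_sub_one_div hc.ne') hexp
      (fun ρ hρ => norm_exp_sub_one_div_le hc (hsub hρ))
    exact (congrArg norm (intervalIntegral.integral_congr fun ρ _ => by ring)).trans_le h
  calc _ ≤ B * (ε ^ (1 - δ) / (1 - δ)) + B * (3 * ε) * ((2 + (1 + δ) / δ) * ε ^ (-δ)) :=
        (norm_add_le _ _).trans (add_le_add hnear hfar)
    _ = B * (ε ^ (1 - δ) / (1 - δ)) + B * 3 * (2 + (1 + δ) / δ) * (ε * ε ^ (-δ)) := by ring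
    _ = _ := by rw [hεpow]; ring
end
end

section
/- Let δ ∈ (0,1) and a ∈ C¹([0,1]). Then there is a constant C depending only on δ such that for all c > 0, | ∫₀¹ e^{icρ} a(ρ) ρ^{−δ} dρ − a(0) c^{δ−1} ∫₀^∞ e^{iρ} ρ^{−δ} dρ | ≤ C c^{−1} ( |a(0)| + ‖a'‖_∞ ). In particular, there exists M > 0 depending only on δ (independent of a) such that, whenever a(0) ≠ 0 and c ≥ M (1 + ‖a'‖_∞ |a(0)|^{−1})^{1/δ}, one has | ∫₀¹ e^{icρ} a(ρ) ρ^{−δ} dρ | ≥ (1/C) c^{δ−1} |a(0)|. -/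
open MeasureTheory Complex Filter
open scoped ENNReal

noncomputable section

/-- A first-derivative bound for oscillatory integrals, by integration by parts. -/
theorem norm_integral_exp_mul_le {u u' : ℝ → ℂ} {G : ℝ → ℝ} {a b c : ℝ} (hab : a ≤ b)
    (hc : 0 < c) (hu : ContinuousOn u (Set.Icc a b))
    (hu' : ∀ x ∈ Set.Ioo a b, HasDerivAt u (u' x) x)
    (hu'c : ContinuousOn u' (Set.Ioo a b)) (hG : IntervalIntegrable G volume a b)
    (hle : ∀ x ∈ Set.Ioo a b, ‖u' x‖ ≤ G x) :
    ‖∫ x in a..b, cexp (I * c * x) * u x‖ ≤ c⁻¹ * (‖u a‖ + ‖u b‖ + ∫ x in a..b, G x) := by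
  have hcC : (I * c : ℂ) ≠ 0 := by simp [hc.ne']
  have hnorm : ∀ x : ℝ, ‖cexp (I * c * x) / (I * c)‖ = c⁻¹ := by
    intro x
    have : I * c * x = ((c * x : ℝ) : ℂ) * I := by push_cast; ring
    rw [norm_div, this, norm_exp_ofReal_mul_I]
    simp [abs_of_pos hc]
  have hv : ∀ x : ℝ, HasDerivAt (fun x : ℝ => cexp (I * c * x) / (I * c))
      (cexp (I * c * x)) x := by
    intro x
    have h1 : HasDerivAt (fun x : ℝ => I * c * (x : ℂ)) (I * c) x := by
      simpa using (ofRealCLM.hasDerivAt (x := x)).const_mul (I * c : ℂ)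
    have h2 := h1.cexp.div_const (I * c)
    rwa [mul_div_cancel_right₀ _ hcC] at h2
  have hint : IntervalIntegrable u' volume a b := by
    rw [intervalIntegrable_iff_integrableOn_Ioo_of_le hab] at hG ⊢
    exact hG.mono' (hu'c.aestronglyMeasurable measurableSet_Ioo)
      ((ae_restrict_iff' measurableSet_Ioo).2 (.of_forall hle))
  have hparts := intervalIntegral.integral_mul_deriv_eq_deriv_mul_of_hasDerivAt
    (u := u) (v := fun x : ℝ => cexp (I * c * x) / (I * c)) (u' := u')
    (v' := fun x : ℝ => cexp (I * c * x)) (a := a) (b := b)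
    (by rwa [Set.uIcc_of_le hab]) (by fun_prop)
    (by rwa [min_eq_left hab, max_eq_right hab]) (fun x _ => hv x) hint
    (Continuous.intervalIntegrable (by fun_prop) _ _)
  simp_rw [mul_comm (cexp _) (u _)]
  rw [hparts]
  have hrem : ‖∫ x in a..b, u' x * (cexp (I * c * x) / (I * c))‖ ≤ ∫ x in a..b, c⁻¹ * G x := by
    refine intervalIntegral.norm_integral_le_of_norm_le hab ?_ (hG.const_mul _)
    filter_upwards [compl_mem_ae_iff.2 (measure_singleton b)] with x hxb hx
    rw [norm_mul, hnorm, mul_comm]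
    exact mul_le_mul_of_nonneg_left (hle x ⟨hx.1, lt_of_le_of_ne hx.2 hxb⟩) (by positivity)
  rw [intervalIntegral.integral_const_mul] at hrem
  calc _ ≤ ‖u b * (cexp (I * c * b) / (I * c))‖ + ‖u a * (cexp (I * c * a) / (I * c))‖
        + ‖∫ x in a..b, u' x * (cexp (I * c * x) / (I * c))‖ :=
        (norm_sub_le _ _).trans (by gcongr; exact norm_sub_le _ _)
    _ ≤ ‖u b‖ * c⁻¹ + ‖u a‖ * c⁻¹ + c⁻¹ * ∫ x in a..b, G x := by
        rw [norm_mul, norm_mul, hnorm, hnorm]; gcongr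
    _ = _ := by ring

theorem hasDerivAt_ofReal_rpow_neg (δ : ℝ) {x : ℝ} (hx : 0 < x) :
    HasDerivAt (fun x : ℝ => ((x ^ (-δ) : ℝ) : ℂ)) ((-δ * x ^ (-δ - 1) : ℝ) : ℂ) x :=
  (Real.hasDerivAt_rpow_const (Or.inl hx.ne')).ofReal_comp

theorem intervalIntegrable_mul_rpow_neg {δ : ℝ} (hδ : δ < 1) {f : ℝ → ℂ} {a b : ℝ}
    (hf : ContinuousOn f (Set.uIcc a b)) :
    IntervalIntegrable (fun ρ : ℝ => f ρ * ((ρ ^ (-δ) : ℝ) : ℂ)) volume a b := by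
  have h := intervalIntegral.intervalIntegrable_rpow' (a := a) (b := b) (r := -δ) (by linarith)
  have h' : IntervalIntegrable (fun ρ : ℝ => ((ρ ^ (-δ) : ℝ) : ℂ)) volume a b :=
    ⟨Integrable.ofReal h.1, Integrable.ofReal h.2⟩
  exact h'.continuousOn_mul hf

theorem norm_integral_exp_mul_rpow_neg_le {δ : ℝ} (hδ : 0 < δ) {c R : ℝ} (hc : 0 < c)
    (hR : c ≤ R) :
    ‖∫ ρ in c..R, cexp (I * ρ) * ((ρ ^ (-δ) : ℝ) : ℂ)‖ ≤ 2 * c ^ (-δ) := by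
  have h0 : (0 : ℝ) ∉ Set.uIcc c R := Set.notMem_uIcc_of_lt hc (hc.trans_le hR)
  have h := norm_integral_exp_mul_le (u := fun x : ℝ => ((x ^ (-δ) : ℝ) : ℂ))
    (u' := fun x : ℝ => ((-δ * x ^ (-δ - 1) : ℝ) : ℂ)) (G := fun x => δ * x ^ (-δ - 1))
    hR one_pos
    (fun x hx => (hasDerivAt_ofReal_rpow_neg δ (hc.trans_le hx.1)).continuousAt.continuousWithinAt)
    (fun x hx => hasDerivAt_ofReal_rpow_neg δ (hc.trans hx.1))
    (continuous_ofReal.comp_continuousOn (continuousOn_const.mul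
      (continuousOn_id.rpow_const fun x hx => Or.inl (hc.trans hx.1).ne')))
    ((intervalIntegral.intervalIntegrable_rpow (Or.inr h0)).const_mul δ)
    (fun x hx => by
      have := Real.rpow_nonneg (hc.trans hx.1).le (-δ - 1)
      rw [norm_real, norm_mul, norm_neg, Real.norm_of_nonneg hδ.le, Real.norm_of_nonneg this])
  have hI : ∫ x in c..R, δ * x ^ (-δ - 1) = c ^ (-δ) - R ^ (-δ) := by
    rw [intervalIntegral.integral_const_mul, integral_rpow (Or.inr ⟨by linarith, h0⟩)]
    rw [show -δ - 1 + 1 = -δ by ring]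
    field_simp
    ring
  rw [hI, norm_real, norm_real, Real.norm_of_nonneg (Real.rpow_nonneg hc.le _),
    Real.norm_of_nonneg (Real.rpow_nonneg (hc.le.trans hR) _)] at h
  simp only [ofReal_one, mul_one, inv_one, one_mul] at h
  linarith

theorem im_integral_exp_mul_rpow_neg_ge {δ : ℝ} (hδ : δ ∈ Set.Ioo (0 : ℝ) 1) {R : ℝ}
    (hR : 1 ≤ R) :
    ∫ ρ in (0 : ℝ)..1, Real.sin ρ * (ρ ^ (-δ) - 1) ≤
      (∫ ρ in (0 : ℝ)..R, cexp (I * ρ) * ((ρ ^ (-δ) : ℝ) : ℂ)).im := by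
  have hrp : ∀ a b : ℝ, IntervalIntegrable (fun x : ℝ => x ^ (-δ)) volume a b := fun a b =>
    intervalIntegral.intervalIntegrable_rpow' (by linarith [hδ.2])
  have hsin : ∀ a b : ℝ, IntervalIntegrable (fun x : ℝ => Real.sin x * x ^ (-δ)) volume a b :=
    fun a b => (hrp a b).continuousOn_mul Real.continuous_sin.continuousOn
  have him : (∫ ρ in (0 : ℝ)..R, cexp (I * ρ) * ((ρ ^ (-δ) : ℝ) : ℂ)).im =
      ∫ ρ in (0 : ℝ)..R, Real.sin ρ * ρ ^ (-δ) := by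
    have h := imCLM.intervalIntegral_comp_comm
      (intervalIntegrable_mul_rpow_neg hδ.2 (a := 0) (b := R) (f := fun ρ : ℝ => cexp (I * ρ)) (by fun_prop))
    rw [← imCLM_apply, ← h]
    refine intervalIntegral.integral_congr fun x _ => ?_
    simp [mul_comm I, exp_ofReal_mul_I_im]
  have h0 : (0 : ℝ) ∉ Set.uIcc 1 R := Set.notMem_uIcc_of_lt one_pos (by linarith)
  have hint : IntervalIntegrable (fun x : ℝ => -δ * x ^ (-δ - 1)) volume 1 R :=
    (intervalIntegral.intervalIntegrable_rpow (Or.inr h0)).const_mul _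
  have hparts := intervalIntegral.integral_mul_deriv_eq_deriv_mul (a := 1) (b := R)
    (u := fun x : ℝ => x ^ (-δ)) (v := fun x => 1 - Real.cos x)
    (u' := fun x : ℝ => -δ * x ^ (-δ - 1)) (v' := Real.sin)
    (fun x hx => Real.hasDerivAt_rpow_const (Or.inl (ne_of_mem_of_not_mem hx h0)))
    (fun x _ => by simpa using (Real.hasDerivAt_cos x).const_sub 1)
    hint (Real.continuous_sin.intervalIntegrable _ _)
  have hneg : ∫ x in (1 : ℝ)..R, -δ * x ^ (-δ - 1) * (1 - Real.cos x) ≤ 0 := by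
    rw [← neg_nonneg, ← intervalIntegral.integral_neg]
    refine intervalIntegral.integral_nonneg hR fun x hx => ?_
    have h1 := Real.rpow_nonneg (zero_le_one.trans hx.1) (-δ - 1)
    have h2 := Real.cos_le_one x
    have := mul_nonneg (mul_nonneg hδ.1.le h1) (sub_nonneg.2 h2)
    linarith
  have hbd : 0 ≤ R ^ (-δ) * (1 - Real.cos R) :=
    mul_nonneg (Real.rpow_nonneg (by linarith) _) (sub_nonneg.2 (Real.cos_le_one R))
  have hlow : ∫ ρ in (0 : ℝ)..1, Real.sin ρ * (ρ ^ (-δ) - 1) =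
      (∫ ρ in (0 : ℝ)..1, Real.sin ρ * ρ ^ (-δ)) - (1 - Real.cos 1) := by
    simp_rw [mul_sub, mul_one]
    rw [intervalIntegral.integral_sub (hsin 0 1) (Real.continuous_sin.intervalIntegrable _ _),
      integral_sin, Real.cos_zero]
  have hcomm : ∫ x in (1 : ℝ)..R, Real.sin x * x ^ (-δ) =
      ∫ x in (1 : ℝ)..R, x ^ (-δ) * Real.sin x :=
    intervalIntegral.integral_congr fun x _ => mul_comm _ _
  rw [him, ← intervalIntegral.integral_add_adjacent_intervals (hsin 0 1) (hsin 1 R), hlow, hcomm,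
    hparts, Real.one_rpow]
  linarith

theorem integral_sin_mul_rpow_neg_sub_one_pos {δ : ℝ} (hδ : δ ∈ Set.Ioo (0 : ℝ) 1) :
    0 < ∫ ρ in (0 : ℝ)..1, Real.sin ρ * (ρ ^ (-δ) - 1) := by
  refine intervalIntegral.intervalIntegral_pos_of_pos_on ?_ (fun x hx => ?_) one_pos
  · exact ((intervalIntegral.intervalIntegrable_rpow' (by linarith [hδ.2])).sub
      (by simp)).continuousOn_mul Real.continuous_sin.continuousOn
  · refine mul_pos (Real.sin_pos_of_pos_of_lt_pi hx.1 (by linarith [hx.2, Real.pi_gt_three])) ?_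
    have := Real.one_lt_rpow_of_pos_of_lt_one_of_neg hx.1 hx.2 (neg_lt_zero.2 hδ.1)
    linarith

theorem norm_integral_exp_mul_sub_mul_rpow_neg_le {δ : ℝ} (hδ : δ ∈ Set.Ioo (0 : ℝ) 1)
    {a a' : ℝ → ℂ} {K c : ℝ} (hc : 0 < c)
    (ha : ∀ ρ ∈ Set.Icc (0 : ℝ) 1, HasDerivWithinAt a (a' ρ) (Set.Icc (0 : ℝ) 1) ρ)
    (ha' : ContinuousOn a' (Set.Icc (0 : ℝ) 1))
    (hK : ∀ ρ ∈ Set.Icc (0 : ℝ) 1, ‖a' ρ‖ ≤ K) :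
    ‖∫ ρ in (0 : ℝ)..1, cexp (I * c * ρ) * ((a ρ - a 0) * ((ρ ^ (-δ) : ℝ) : ℂ))‖ ≤
      2 / (1 - δ) * c⁻¹ * K := by
  obtain ⟨hδ0, hδ1⟩ := hδ
  have h1δ : 0 < 1 - δ := by linarith
  have hlip : ∀ ρ ∈ Set.Icc (0 : ℝ) 1, ‖a ρ - a 0‖ ≤ K * ρ := fun ρ hρ => by
    simpa using norm_image_sub_le_of_norm_deriv_le_segment' ha
      (fun x hx => hK x (Set.Ico_subset_Icc_self hx)) ρ hρ
  have hac : ContinuousOn a (Set.Icc 0 1) := fun x hx => (ha x hx).continuousWithinAt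
  have hderiv : ∀ x ∈ Set.Ioo (0 : ℝ) 1,
      HasDerivAt (fun ρ : ℝ => (a ρ - a 0) * ((ρ ^ (-δ) : ℝ) : ℂ))
        (a' x * ((x ^ (-δ) : ℝ) : ℂ) + (a x - a 0) * ((-δ * x ^ (-δ - 1) : ℝ) : ℂ)) x :=
    fun x hx => (((ha x (Set.Ioo_subset_Icc_self hx)).hasDerivAt
      (Icc_mem_nhds hx.1 hx.2)).sub_const (a 0)).mul (hasDerivAt_ofReal_rpow_neg δ hx.1)
  have hcont : ContinuousOn (fun ρ : ℝ => (a ρ - a 0) * ((ρ ^ (-δ) : ℝ) : ℂ))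
      (Set.Icc 0 1) := by
    intro x hx
    rcases hx.1.eq_or_lt with rfl | hx0
    · have hlim : Tendsto (fun ρ : ℝ => K * ρ ^ (1 - δ)) (nhdsWithin 0 (Set.Icc 0 1))
          (nhds 0) := by
        have h : ContinuousAt (fun ρ : ℝ => K * ρ ^ (1 - δ)) 0 :=
          continuousAt_const.mul (Real.continuousAt_rpow_const _ _ (Or.inr h1δ.le))
        simpa [ContinuousAt, Real.zero_rpow h1δ.ne'] using h.tendsto.mono_left nhdsWithin_le_nhds
      have := squeeze_zero_norm' (f := fun ρ : ℝ => (a ρ - a 0) * ((ρ ^ (-δ) : ℝ) : ℂ)) ?_ hlim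
      · simpa [ContinuousWithinAt] using this
      · filter_upwards [self_mem_nhdsWithin] with ρ hρ
        have hr := Real.rpow_nonneg hρ.1 (-δ)
        rw [norm_mul, norm_real, Real.norm_of_nonneg hr, sub_eq_add_neg (1 : ℝ) δ]
        rw [Real.rpow_add' hρ.1 (by linarith), Real.rpow_one, ← mul_assoc]
        gcongr
        exact hlip ρ hρ
    · exact ((hac x hx).sub continuousWithinAt_const).mul
        (hasDerivAt_ofReal_rpow_neg δ hx0).continuousAt.continuousWithinAt
  have hrc : ∀ r : ℝ, ContinuousOn (fun x : ℝ => x ^ r) (Set.Ioo 0 1) := fun r =>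
    continuousOn_id.rpow_const fun x hx => Or.inl hx.1.ne'
  have h := norm_integral_exp_mul_le (G := fun x => K * (1 + δ) * x ^ (-δ)) zero_le_one hc hcont
    hderiv
    (((ha'.mono Set.Ioo_subset_Icc_self).mul (continuous_ofReal.comp_continuousOn (hrc _))).add
      (((hac.mono Set.Ioo_subset_Icc_self).sub continuousOn_const).mul
        (continuous_ofReal.comp_continuousOn (continuousOn_const.mul (hrc _)))))
    ((intervalIntegral.intervalIntegrable_rpow' (by linarith)).const_mul _)
    (fun x hx => by
      have hx' := Set.Ioo_subset_Icc_self hx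
      have hr := Real.rpow_nonneg hx.1.le (-δ)
      have hr' := Real.rpow_nonneg hx.1.le (-δ - 1)
      have hxr : x * x ^ (-δ - 1) = x ^ (-δ) := by
        rw [Real.rpow_sub_one hx.1.ne']; field_simp [hx.1.ne']
      refine (norm_add_le _ _).trans ?_
      rw [norm_mul, norm_mul, norm_real, norm_real, norm_mul, norm_neg, Real.norm_of_nonneg hr,
        Real.norm_of_nonneg hr', Real.norm_of_nonneg hδ0.le]
      calc _ ≤ K * x ^ (-δ) + K * x * (δ * x ^ (-δ - 1)) := by
            gcongr
            · exact hK x hx'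
            · exact hlip x hx'
        _ = K * x ^ (-δ) + K * δ * (x * x ^ (-δ - 1)) := by ring
        _ = _ := by rw [hxr]; ring)
  refine h.trans ?_
  have h1 := hlip 1 ⟨zero_le_one, le_rfl⟩
  rw [intervalIntegral.integral_const_mul, integral_rpow (Or.inl (by linarith))]
  rw [show -δ + 1 = 1 - δ by ring, Real.zero_rpow h1δ.ne', Real.one_rpow]
  simp only [sub_self, zero_mul, norm_zero, Real.one_rpow, ofReal_one, mul_one, zero_add, sub_zero]
  calc _ ≤ c⁻¹ * (K + K * (1 + δ) * (1 / (1 - δ))) := by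
        gcongr; simpa using h1
    _ = _ := by field_simp; ring

theorem exists_tendsto_integral_exp_mul_rpow_neg {δ : ℝ} (hδ : δ ∈ Set.Ioo (0 : ℝ) 1) :
    ∃ L : ℂ, L ≠ 0 ∧
      Tendsto (fun R : ℝ => ∫ ρ in (0 : ℝ)..R, cexp (I * ρ) * ((ρ ^ (-δ) : ℝ) : ℂ))
        atTop (nhds L) ∧
      ∀ c : ℝ, 0 < c →
        ‖(∫ ρ in (0 : ℝ)..c, cexp (I * ρ) * ((ρ ^ (-δ) : ℝ) : ℂ)) - L‖ ≤ 2 * c ^ (-δ) := by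
  set F : ℝ → ℂ := fun R => ∫ ρ in (0 : ℝ)..R, cexp (I * ρ) * ((ρ ^ (-δ) : ℝ) : ℂ) with hF
  have hint : ∀ a b : ℝ,
      IntervalIntegrable (fun ρ : ℝ => cexp (I * ρ) * ((ρ ^ (-δ) : ℝ) : ℂ)) volume a b :=
    fun a b => intervalIntegrable_mul_rpow_neg hδ.2 (by fun_prop)
  have hdist : ∀ c R : ℝ, 0 < c → c ≤ R → ‖F c - F R‖ ≤ 2 * c ^ (-δ) := by
    intro c R hc hR
    rw [norm_sub_rev, hF]
    simp only
    rw [intervalIntegral.integral_interval_sub_left (hint _ _) (hint _ _)]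
    exact norm_integral_exp_mul_rpow_neg_le hδ.1 hc hR
  have hlim0 : Tendsto (fun c : ℝ => 2 * c ^ (-δ)) atTop (nhds 0) := by
    simpa using (tendsto_rpow_neg_atTop hδ.1).const_mul 2
  have hcauchy : Cauchy (map F atTop) := by
    rw [Metric.cauchy_iff]
    refine ⟨inferInstance, fun ε hε => ?_⟩
    obtain ⟨N, hN, hN0⟩ := ((hlim0.eventually (gt_mem_nhds (half_pos hε))).and
      (eventually_gt_atTop 0)).exists
    refine ⟨F '' Set.Ici N, image_mem_map (Ici_mem_atTop N), ?_⟩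
    rintro _ ⟨x, hx, rfl⟩ _ ⟨y, hy, rfl⟩
    calc dist (F x) (F y) ≤ dist (F N) (F x) + dist (F N) (F y) := dist_triangle_left _ _ _
      _ < ε := by
        rw [dist_eq_norm, dist_eq_norm]
        linarith [hdist N x hN0 hx, hdist N y hN0 hy]
  obtain ⟨L, hL⟩ := cauchy_map_iff_exists_tendsto.1 hcauchy
  refine ⟨L, ?_, hL, fun c hc => ?_⟩
  · rintro rfl
    have him : Tendsto (fun R => (F R).im) atTop (nhds (0 : ℂ).im) :=
      (continuous_im.tendsto _).comp hL
    have := ge_of_tendsto him ((eventually_ge_atTop 1).mono fun R hR =>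
      im_integral_exp_mul_rpow_neg_ge hδ hR)
    exact absurd (integral_sin_mul_rpow_neg_sub_one_pos hδ) (not_lt.2 (by simpa using this))
  · exact le_of_tendsto (hL.const_sub (F c)).norm
      ((eventually_ge_atTop c).mono fun R hR => hdist c R hc hR)

theorem integral_exp_mul_rpow_neg_scale (δ : ℝ) {c : ℝ} (hc : 0 < c) :
    ∫ ρ in (0 : ℝ)..1, cexp (I * c * ρ) * ((ρ ^ (-δ) : ℝ) : ℂ) =
      ((c ^ (δ - 1) : ℝ) : ℂ) * ∫ ρ in (0 : ℝ)..c, cexp (I * ρ) * ((ρ ^ (-δ) : ℝ) : ℂ) := by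
  have h := intervalIntegral.integral_comp_mul_left (a := 0) (b := 1)
    (fun ρ : ℝ => cexp (I * ρ) * ((ρ ^ (-δ) : ℝ) : ℂ)) hc.ne'
  rw [mul_zero, mul_one] at h
  have hpow : c ^ (δ - 1) = c ^ δ * c⁻¹ := by rw [Real.rpow_sub_one hc.ne', div_eq_mul_inv]
  rw [hpow, ofReal_mul, mul_assoc, ← real_smul (x := c⁻¹), ← h, ← intervalIntegral.integral_const_mul]
  refine intervalIntegral.integral_congr fun x hx => ?_
  rw [Set.uIcc_of_le zero_le_one] at hx
  have hmul : x ^ (-δ) = c ^ δ * (c * x) ^ (-δ) := by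
    rw [Real.mul_rpow hc.le hx.1, ← mul_assoc, ← Real.rpow_add hc]; simp
  rw [hmul]
  push_cast
  ring_nf

theorem norm_le_iSup_Icc {f : ℝ → ℂ} (hf : ContinuousOn f (Set.Icc 0 1)) {x : ℝ}
    (hx : x ∈ Set.Icc (0 : ℝ) 1) : ‖f x‖ ≤ ⨆ ρ ∈ Set.Icc (0 : ℝ) 1, ‖f ρ‖ := by
  obtain ⟨B, hB⟩ := isCompact_Icc.exists_bound_of_continuousOn hf
  have hB0 : 0 ≤ B := (norm_nonneg _).trans (hB x hx)
  have hbdd : BddAbove (Set.range fun ρ : ℝ => ⨆ _ : ρ ∈ Set.Icc (0 : ℝ) 1, ‖f ρ‖) :=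
    ⟨B, by rintro _ ⟨ρ, rfl⟩; exact Real.iSup_le (fun h => hB ρ h) hB0⟩
  exact (ciSup_pos (f := fun _ => ‖f x‖) hx).ge.trans (le_ciSup hbdd x)

/-- **Proposition (singular oscillatory integral, asymptotics and lower bound).**
Let δ ∈ (0,1). The improper integral L = ∫₀^∞ e^{iρ} ρ^{−δ} dρ converges and is nonzero, and
there is C = C(δ) > 0 such that for every a ∈ C¹([0,1]) (given with its derivative a') and
every c > 0: |∫₀¹ e^{icρ} a(ρ) ρ^{−δ} dρ − a(0) c^{δ−1} L| ≤ C c^{−1} (|a(0)| + ‖a'‖_∞).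
In particular there is M = M(δ) > 0, independent of a, such that if a(0) ≠ 0 and
c ≥ M (1 + ‖a'‖_∞ |a(0)|⁻¹)^{1/δ} then |∫₀¹ e^{icρ} a(ρ) ρ^{−δ} dρ| ≥ C⁻¹ c^{δ−1} |a(0)|. -/
theorem stmt_11 (δ : ℝ) (hδ : δ ∈ Set.Ioo (0 : ℝ) 1) :
    ∃ L : ℂ, L ≠ 0 ∧
      Tendsto (fun R : ℝ =>
          ∫ ρ in (0 : ℝ)..R, Complex.exp (Complex.I * ρ) * ((ρ ^ (-δ) : ℝ) : ℂ))
        atTop (nhds L) ∧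
      ∃ C : ℝ, 0 < C ∧
        (∀ a a' : ℝ → ℂ,
          (∀ ρ ∈ Set.Icc (0 : ℝ) 1, HasDerivWithinAt a (a' ρ) (Set.Icc (0 : ℝ) 1) ρ) →
          ContinuousOn a' (Set.Icc (0 : ℝ) 1) →
          ∀ c : ℝ, 0 < c →
            ‖(∫ ρ in (0 : ℝ)..1, Complex.exp (Complex.I * c * ρ) * a ρ * ((ρ ^ (-δ) : ℝ) : ℂ)) -
                a 0 * ((c ^ (δ - 1) : ℝ) : ℂ) * L‖ ≤
              C * c⁻¹ * (‖a 0‖ + ⨆ ρ ∈ Set.Icc (0 : ℝ) 1, ‖a' ρ‖)) ∧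
        ∃ M : ℝ, 0 < M ∧
          ∀ a a' : ℝ → ℂ,
            (∀ ρ ∈ Set.Icc (0 : ℝ) 1, HasDerivWithinAt a (a' ρ) (Set.Icc (0 : ℝ) 1) ρ) →
            ContinuousOn a' (Set.Icc (0 : ℝ) 1) →
            a 0 ≠ 0 →
            ∀ c : ℝ,
              M * (1 + (⨆ ρ ∈ Set.Icc (0 : ℝ) 1, ‖a' ρ‖) * ‖a 0‖⁻¹) ^ (1 / δ) ≤ c →
              C⁻¹ * c ^ (δ - 1) * ‖a 0‖ ≤
                ‖∫ ρ in (0 : ℝ)..1, Complex.exp (Complex.I * c * ρ) * a ρ * ((ρ ^ (-δ) : ℝ) : ℂ)‖ := by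
  obtain ⟨L, hL0, hL, hdist⟩ := exists_tendsto_integral_exp_mul_rpow_neg hδ
  have h1δ : 0 < 1 - δ := by linarith [hδ.2]
  have hLpos : 0 < ‖L‖ := norm_pos_iff.2 hL0
  set C : ℝ := 2 / (1 - δ) + 2 / ‖L‖ with hC
  have hCpos : 0 < C := by positivity
  have hmain : ∀ a a' : ℝ → ℂ,
      (∀ ρ ∈ Set.Icc (0 : ℝ) 1, HasDerivWithinAt a (a' ρ) (Set.Icc (0 : ℝ) 1) ρ) →
      ContinuousOn a' (Set.Icc (0 : ℝ) 1) →
      ∀ c : ℝ, 0 < c →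
        ‖(∫ ρ in (0 : ℝ)..1, Complex.exp (Complex.I * c * ρ) * a ρ * ((ρ ^ (-δ) : ℝ) : ℂ)) -
            a 0 * ((c ^ (δ - 1) : ℝ) : ℂ) * L‖ ≤
          C * c⁻¹ * (‖a 0‖ + ⨆ ρ ∈ Set.Icc (0 : ℝ) 1, ‖a' ρ‖) := by
    intro a a' ha ha' c hc
    set K := ⨆ ρ ∈ Set.Icc (0 : ℝ) 1, ‖a' ρ‖
    have hK : ∀ ρ ∈ Set.Icc (0 : ℝ) 1, ‖a' ρ‖ ≤ K := fun ρ hρ => norm_le_iSup_Icc ha' hρ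
    have hK0 : 0 ≤ K := (norm_nonneg _).trans (hK 0 ⟨le_rfl, zero_le_one⟩)
    have hac : ContinuousOn a (Set.uIcc 0 1) := by
      rw [Set.uIcc_of_le zero_le_one]
      exact fun x hx => (ha x hx).continuousWithinAt
    have hsplit : ∫ ρ in (0 : ℝ)..1, cexp (I * c * ρ) * a ρ * ((ρ ^ (-δ) : ℝ) : ℂ) =
        (∫ ρ in (0 : ℝ)..1, cexp (I * c * ρ) * ((a ρ - a 0) * ((ρ ^ (-δ) : ℝ) : ℂ))) +
          a 0 * ∫ ρ in (0 : ℝ)..1, cexp (I * c * ρ) * ((ρ ^ (-δ) : ℝ) : ℂ) := by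
      have hexp : ContinuousOn (fun ρ : ℝ => cexp (I * c * ρ)) (Set.uIcc 0 1) := by fun_prop
      rw [← intervalIntegral.integral_const_mul, ← intervalIntegral.integral_add]
      · exact intervalIntegral.integral_congr fun x _ => by ring
      · simpa only [mul_assoc] using intervalIntegrable_mul_rpow_neg
          (f := fun ρ => cexp (I * c * ρ) * (a ρ - a 0)) hδ.2
          (hexp.mul (hac.sub continuousOn_const))
      · exact (intervalIntegrable_mul_rpow_neg hδ.2 hexp).const_mul _
    have hpow : c ^ (δ - 1) * c ^ (-δ) = c⁻¹ := by
      rw [← Real.rpow_add hc, ← Real.rpow_neg_one]; ring_nf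
    have h2 : 2 ≤ C := by
      have : 2 ≤ 2 / (1 - δ) := by rw [le_div_iff₀ h1δ]; linarith [hδ.1]
      have : 0 < 2 / ‖L‖ := by positivity
      linarith
    have hCle : 2 / (1 - δ) ≤ C := by
      have : 0 < 2 / ‖L‖ := by positivity
      linarith
    rw [hsplit, integral_exp_mul_rpow_neg_scale δ hc]
    set F := ∫ ρ in (0 : ℝ)..c, cexp (I * ρ) * ((ρ ^ (-δ) : ℝ) : ℂ)
    calc _ = ‖(∫ ρ in (0 : ℝ)..1, cexp (I * c * ρ) * ((a ρ - a 0) * ((ρ ^ (-δ) : ℝ) : ℂ))) +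
          a 0 * ((c ^ (δ - 1) : ℝ) : ℂ) * (F - L)‖ := by congr 1; ring
      _ ≤ 2 / (1 - δ) * c⁻¹ * K + ‖a 0‖ * c ^ (δ - 1) * (2 * c ^ (-δ)) := by
        refine (norm_add_le _ _).trans <| add_le_add
          (norm_integral_exp_mul_sub_mul_rpow_neg_le hδ hc ha ha' hK) ?_
        rw [norm_mul, norm_mul, norm_real, Real.norm_of_nonneg (Real.rpow_nonneg hc.le _)]
        gcongr
        exact hdist c hc
      _ = 2 / (1 - δ) * c⁻¹ * K + 2 * (c ^ (δ - 1) * c ^ (-δ)) * ‖a 0‖ := by ring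
      _ ≤ C * c⁻¹ * K + C * c⁻¹ * ‖a 0‖ := by rw [hpow]; gcongr
      _ = _ := by ring
  refine ⟨L, hL0, hL, C, hCpos, hmain, (2 * C / ‖L‖) ^ (1 / δ), by positivity, ?_⟩
  intro a a' ha ha' ha0 c hcM
  have h := hmain a a' ha ha' c
  set K := ⨆ ρ ∈ Set.Icc (0 : ℝ) 1, ‖a' ρ‖
  have hK0 : 0 ≤ K := (norm_nonneg _).trans (norm_le_iSup_Icc ha' ⟨le_rfl, zero_le_one⟩)
  have ha0' : 0 < ‖a 0‖ := norm_pos_iff.2 ha0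
  have hB : 0 < 2 * C / ‖L‖ * (1 + K * ‖a 0‖⁻¹) := by positivity
  rw [← Real.mul_rpow (by positivity) (by positivity)] at hcM
  have hc : 0 < c := (Real.rpow_pos_of_pos hB _).trans_le hcM
  have hcδ : 2 * C / ‖L‖ * (1 + K * ‖a 0‖⁻¹) ≤ c ^ δ := by
    have := Real.rpow_le_rpow (by positivity) hcM hδ.1.le
    rwa [← Real.rpow_mul hB.le, one_div_mul_cancel hδ.1.ne', Real.rpow_one] at this
  have hsum : C * (‖a 0‖ + K) ≤ c ^ δ * (‖L‖ / 2) * ‖a 0‖ := by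
    calc C * (‖a 0‖ + K) = 2 * C / ‖L‖ * (1 + K * ‖a 0‖⁻¹) * (‖L‖ / 2) * ‖a 0‖ := by field_simp
      _ ≤ _ := by gcongr
  have hpow : c ^ (δ - 1) = c ^ δ * c⁻¹ := by rw [Real.rpow_sub_one hc.ne', div_eq_mul_inv]
  have herr : C * c⁻¹ * (‖a 0‖ + K) ≤ c ^ (δ - 1) * (‖L‖ / 2) * ‖a 0‖ := by
    calc _ = c⁻¹ * (C * (‖a 0‖ + K)) := by ring
      _ ≤ c⁻¹ * (c ^ δ * (‖L‖ / 2) * ‖a 0‖) := by gcongr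
      _ = _ := by rw [hpow]; ring
  have hCinv : C⁻¹ ≤ ‖L‖ / 2 := by
    rw [inv_le_comm₀ hCpos (by positivity), inv_div]
    have : 0 < 2 / (1 - δ) := by positivity
    linarith
  have htri := norm_sub_norm_le (a 0 * ((c ^ (δ - 1) : ℝ) : ℂ) * L)
    (∫ ρ in (0 : ℝ)..1, cexp (I * c * ρ) * a ρ * ((ρ ^ (-δ) : ℝ) : ℂ))
  rw [norm_sub_rev, norm_mul, norm_mul, norm_real,
    Real.norm_of_nonneg (Real.rpow_nonneg hc.le _)] at htri
  have hlow : C⁻¹ * c ^ (δ - 1) * ‖a 0‖ ≤ ‖L‖ / 2 * c ^ (δ - 1) * ‖a 0‖ := by gcongr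
  linarith [h hc]
end
end
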